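/- arXiv:1910.05651 — 8 statements merged into one kernel-verified Lean document; each statement's English description precedes it below -/
import Mathlib

section
/- Let V be a finite nonempty set and let r be a binary relation on V with no directed cycles (there is no sequence v_0, v_1, …, v_m = v_0 with m ≥ 1 and r v_i v_{i+1} for all 0 ≤ i < m). Suppose the simple graph G on V with adjacency Adj(u,v) := (u ≠ v ∧ (r u v ∨ r v u)) is connected, and r has no v-structure, i.e., there are no distinct vertices a, b, c with r a c and r b c such that ¬Adj(a,b). Then there is exactly one vertex x ∈ V with no incoming edge, i.e., exactly one x such that ¬ r y x for every y ∈ V. -/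
open Relation in
/-- A pair in the transitive closure of `r` is joined by a nonempty `r`-path. -/
theorem Relation.TransGen.exists_path {α : Type*} {r : α → α → Prop} {a b : α}
    (h : TransGen r a b) :
    ∃ (m : ℕ) (v : ℕ → α), 1 ≤ m ∧ v 0 = a ∧ v m = b ∧ ∀ i < m, r (v i) (v (i + 1)) := by
  induction h using TransGen.head_induction_on with
  | @single a h =>
    refine ⟨1, fun i => if i = 0 then a else b, le_rfl, by simp, by simp, fun i hi => ?_⟩
    obtain rfl : i = 0 := by omega
    simpa using h
  | @head a c h _ ih =>
    obtain ⟨m, v, -, rfl, hm, hv⟩ := ih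
    refine ⟨m + 1, fun i => Nat.casesOn i a v, by omega, rfl, hm, fun i hi => ?_⟩
    cases i with
    | zero => exact h
    | succ i => exact hv i (by omega)

/-- On a finite type, a relation without directed cycles is well-founded. -/
theorem wellFounded_of_no_directed_cycle {α : Type*} [Finite α] {r : α → α → Prop}
    (h : ¬ ∃ (m : ℕ) (v : ℕ → α), 1 ≤ m ∧ v m = v 0 ∧ ∀ i < m, r (v i) (v (i + 1))) :
    WellFounded r := by
  have : Std.Irrefl (Relation.TransGen r) := ⟨fun a ha => by
    obtain ⟨m, v, hm, h0, hv, hr⟩ := ha.exists_path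
    exact h ⟨m, v, hm, hv.trans h0.symm, hr⟩⟩
  exact Subrelation.wf Relation.TransGen.single
    (Finite.wellFounded_of_trans_of_irrefl (Relation.TransGen r))

open Relation in
/-- Every element is reached from a source of a well-founded relation. -/
theorem WellFounded.exists_source_reflTransGen {α : Type*} {r : α → α → Prop}
    (hwf : WellFounded r) (c : α) : ∃ x, (∀ y, ¬ r y x) ∧ ReflTransGen r x c := by
  induction c using hwf.induction with
  | _ c ih =>
    by_cases hc : ∀ y, ¬ r y c
    · exact ⟨c, hc, .refl⟩
    · push Not at hc
      obtain ⟨y, hy⟩ := hc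
      obtain ⟨x, hx, hxy⟩ := ih y hy
      exact ⟨x, hx, hxy.tail hy⟩

open Relation in
/-- If any two distinct predecessors of a vertex are related, then a vertex is reached from at
most one source. -/
theorem WellFounded.source_unique {α : Type*} {r : α → α → Prop} (hwf : WellFounded r)
    (hr : ∀ a b c, r a c → r b c → a = b ∨ r a b ∨ r b a) {x y : α}
    (hx : ∀ z, ¬ r z x) (hy : ∀ z, ¬ r z y) (c : α)
    (hxc : ReflTransGen r x c) (hyc : ReflTransGen r y c) : x = y := by
  induction c using hwf.induction with
  | _ c ih =>
    rcases hxc.cases_tail with rfl | ⟨a, hxa, hac⟩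
    · rcases hyc.cases_tail with h | ⟨b, -, hb⟩
      · exact h
      · exact (hx b hb).elim
    rcases hyc.cases_tail with rfl | ⟨b, hyb, hbc⟩
    · exact (hy a hac).elim
    rcases hr a b c hac hbc with rfl | hab | hba
    · exact ih a hac hxa hyb
    · exact ih b hbc (hxa.tail hab) hyb
    · exact ih a hac hxa (hyb.tail hba)


/-- **Lemma 2**: Let `V` be a finite nonempty set and `r` a binary relation on `V` with no
directed cycles.  If the skeleton (the simple graph with adjacency
`u ≠ v ∧ (r u v ∨ r v u)`) is connected and `r` has no v-structure, then there is exactly one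
vertex with no incoming `r`-edge. -/
theorem rooted_unique_of_vStructureFree_connected_acyclic
    {V : Type*} [Fintype V] [Nonempty V] (r : V → V → Prop)
    (hacyc : ¬ ∃ (m : ℕ) (v : ℕ → V), 1 ≤ m ∧ v m = v 0 ∧ ∀ i < m, r (v i) (v (i + 1)))
    (hconn : (SimpleGraph.fromRel r).Connected)
    (hnov : ¬ ∃ a b c : V, a ≠ b ∧ a ≠ c ∧ b ≠ c ∧ r a c ∧ r b c ∧
      ¬ (SimpleGraph.fromRel r).Adj a b) :
    ∃! x : V, ∀ y : V, ¬ r y x := by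
  have hwf := wellFounded_of_no_directed_cycle hacyc
  have hr : ∀ a b c, r a c → r b c → a = b ∨ r a b ∨ r b a := by
    intro a b c hac hbc
    by_contra! h
    refine hnov ⟨a, b, c, h.1, ?_, ?_, hac, hbc, by simp [h]⟩
    · rintro rfl
      exact hwf.irrefl.irrefl a hac
    · rintro rfl
      exact hwf.irrefl.irrefl b hbc
  obtain ⟨x, hx, -⟩ := hwf.exists_source_reflTransGen (Classical.arbitrary V)
  have hreach : ∀ v, Relation.ReflTransGen r x v := by
    intro v
    have hv := (SimpleGraph.reachable_iff_reflTransGen x v).1 (hconn.preconnected x v)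
    induction hv with
    | refl => exact .refl
    | @tail u v _ huv ih =>
      rcases huv.2 with huv | hvu
      · exact ih.tail huv
      · obtain ⟨z, hz, hzv⟩ := hwf.exists_source_reflTransGen v
        exact hwf.source_unique hr hx hz u ih (hzv.tail hvu) ▸ hzv
  exact ⟨x, hx, fun y hy => (hwf.source_unique hr hx hy y (hreach y) .refl).symm⟩
end

section
/- Let T be a finite tree (a connected acyclic simple graph) on vertex set V, and let r₁ and r₂ be two orientations of T (relations with, for all u, v ∈ V: T.Adj u v ↔ (rᵢ u v ∨ rᵢ v u), and ¬(rᵢ u v ∧ rᵢ v u)) each having no v-structure, i.e., no distinct a, b, c with rᵢ a c and rᵢ b c such that a and b are non-adjacent in T. If some vertex X ∈ V is a root of both orientations (¬ r₁ y X and ¬ r₂ y X for all y), then r₁ = r₂. In other words, for a tree, the location of the root vertex uniquely determines the direction of every edge among v-structure-free orientations. -/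
/-- In a connected graph, an orientation without v-structures directs every edge away from a root:
if `v` is one step further from the root `X` than its neighbour `u`, the edge points to `v`. -/
theorem orientation_of_dist_eq_add_one {V : Type*} {G : SimpleGraph V} (hG : G.Connected)
    {r : V → V → Prop}
    (hor : ∀ u v : V, (G.Adj u v ↔ (r u v ∨ r v u)) ∧ ¬ (r u v ∧ r v u))
    (hnov : ¬ ∃ a b c : V, a ≠ b ∧ a ≠ c ∧ b ≠ c ∧ r a c ∧ r b c ∧ ¬ G.Adj a b)
    {X : V} (hX : ∀ y : V, ¬ r y X) {u v : V} (huv : G.Adj u v)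
    (hd : G.dist X v = G.dist X u + 1) : r u v := by
  induction h : G.dist X u generalizing u v with
  | zero =>
    obtain rfl := hG.dist_eq_zero_iff.mp h
    exact ((hor _ _).1.mp huv).resolve_right (hX v)
  | succ n ih =>
    refine ((hor _ _).1.mp huv).resolve_right fun hvu => ?_
    obtain ⟨w, hwu, hw⟩ : ∃ w, G.Adj w u ∧ G.dist X w = n := by
      obtain ⟨p, hp⟩ := hG.exists_walk_length_eq_dist X u
      have hnil : ¬ p.Nil := by
        rw [← SimpleGraph.Walk.length_eq_zero_iff]
        omega
      have hadj := p.adj_penultimate hnil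
      refine ⟨p.penultimate, hadj, ?_⟩
      have hle := SimpleGraph.dist_le p.dropLast
      have hlen : p.dropLast.length = p.length - 1 := by simp
      have htri := hG.dist_triangle (u := X) (v := p.penultimate) (w := u)
      rw [SimpleGraph.dist_eq_one_iff_adj.mpr hadj] at htri
      omega
    refine hnov ⟨w, v, u, ?_, hwu.ne, huv.ne', ih hwu (by omega) hw, hvu, fun hwv => ?_⟩
    · rintro rfl
      omega
    · have htri := hG.dist_triangle (u := X) (v := w) (w := v)
      rw [SimpleGraph.dist_eq_one_iff_adj.mpr hwv] at htri
      omega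

/-- In a tree, an orientation without v-structures and with root `X` consists of the edges directed
away from `X`. -/
theorem tree_orientation_iff {V : Type*} {T : SimpleGraph V} (hT : T.IsTree) {r : V → V → Prop}
    (hor : ∀ u v : V, (T.Adj u v ↔ (r u v ∨ r v u)) ∧ ¬ (r u v ∧ r v u))
    (hnov : ¬ ∃ a b c : V, a ≠ b ∧ a ≠ c ∧ b ≠ c ∧ r a c ∧ r b c ∧ ¬ T.Adj a b)
    {X : V} (hX : ∀ y : V, ¬ r y X) (u v : V) :
    r u v ↔ T.Adj u v ∧ T.dist X v = T.dist X u + 1 := by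
  refine ⟨fun h => ?_, fun h => orientation_of_dist_eq_add_one hT.connected hor hnov hX h.1 h.2⟩
  have hadj : T.Adj u v := (hor u v).1.mpr (Or.inl h)
  refine ⟨hadj, (hT.dist_eq_dist_add_one_of_adj X hadj).resolve_left fun hd => ?_⟩
  exact (hor u v).2
    ⟨h, orientation_of_dist_eq_add_one hT.connected hor hnov hX hadj.symm hd⟩


/-- **Lemma 5**: For a finite tree `T`, two v-structure-free orientations of `T` with a common
root vertex are equal: the location of the root determines the direction of every edge. -/
theorem tree_orientation_eq_of_common_root
    {V : Type*} [Fintype V] (T : SimpleGraph V) (hT : T.IsTree)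
    (r₁ r₂ : V → V → Prop)
    (hor₁ : ∀ u v : V, (T.Adj u v ↔ (r₁ u v ∨ r₁ v u)) ∧ ¬ (r₁ u v ∧ r₁ v u))
    (hor₂ : ∀ u v : V, (T.Adj u v ↔ (r₂ u v ∨ r₂ v u)) ∧ ¬ (r₂ u v ∧ r₂ v u))
    (hnov₁ : ¬ ∃ a b c : V, a ≠ b ∧ a ≠ c ∧ b ≠ c ∧ r₁ a c ∧ r₁ b c ∧ ¬ T.Adj a b)
    (hnov₂ : ¬ ∃ a b c : V, a ≠ b ∧ a ≠ c ∧ b ≠ c ∧ r₂ a c ∧ r₂ b c ∧ ¬ T.Adj a b)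
    (X : V) (hX₁ : ∀ y : V, ¬ r₁ y X) (hX₂ : ∀ y : V, ¬ r₂ y X) :
    r₁ = r₂ := by
  ext u v
  rw [tree_orientation_iff hT hor₁ hnov₁ hX₁, tree_orientation_iff hT hor₂ hnov₂ hX₂]
end

section
/- Let T be a finite tree with vertex set V of cardinality n, let X ∈ V be a root, and let w ∈ V. Then the set of edges of T identified by the singleton set {w} with respect to root X is exactly the set of edges of T having at least one endpoint in Desc_X(w). In particular, an intervention on a single variable w determines the directions of precisely the edges incident to the descendants of w, and no others. -/
/-- In the `X`-rooted orientation of the tree `T`, the edge `{u,v}` is directed as `u → v`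
exactly when `u` and `v` are adjacent and `u` lies on the (unique) path in `T` from `X` to
`v` (all edges point away from the root `X`). -/
def rootedDir {V : Type*} (T : SimpleGraph V) (X u v : V) : Prop :=
  T.Adj u v ∧ ∀ p : T.Path X v, u ∈ p.val.support

/-- The `X`-rooted and `Y`-rooted orientations of `T` assign the same direction to the
edge `e`. -/
def agreesOn {V : Type*} (T : SimpleGraph V) (X Y : V) (e : Sym2 V) : Prop :=
  ∀ u v : V, e = s(u, v) → (rootedDir T X u v ↔ rootedDir T Y u v)

/-- An edge `e` of `T` is *identified* by the target set `I` with respect to the root `X` if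
every vertex `Y` whose rooted orientation `T^Y` assigns the same direction as `T^X` to every
edge incident to a vertex of `I` also assigns the same direction as `T^X` to `e`. -/
def identified {V : Type*} (T : SimpleGraph V) (X : V) (I : Set V) (e : Sym2 V) : Prop :=
  e ∈ T.edgeSet ∧
    ∀ Y : V, (∀ e' ∈ T.edgeSet, (∃ x ∈ I, x ∈ e') → agreesOn T X Y e') → agreesOn T X Y e

/-- The gain `D(I, T^X)`: the number of edges of `T` identified by `I` with respect to the
root `X`. -/
noncomputable def gain {V : Type*} (T : SimpleGraph V) (X : V) (I : Set V) : ℕ :=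
  {e | identified T X I e}.ncard

/-- `Desc_X(w)`: the set of vertices `v` such that `w` lies on the unique path from `X`
to `v`. -/
def desc {V : Type*} (T : SimpleGraph V) (X w : V) : Set V :=
  {v | ∀ p : T.Path X v, w ∈ p.val.support}

/-- The vertex set of the connected component containing `y` of the subgraph of `T` induced
on the complement of `I`. -/
def comp {V : Type*} (T : SimpleGraph V) (I : Set V) (y : V) : Set V :=
  {z | ∃ p : T.Walk y z, ∀ u ∈ p.support, u ∉ I}

section Descendants

variable {V : Type*} {T : SimpleGraph V} {X Y u v w : V}

lemma mem_desc_iff_forall_walk : v ∈ desc T X w ↔ ∀ p : T.Walk X v, w ∈ p.support := by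
  classical
  exact ⟨fun h p ↦ p.support_bypass_subset_support (h p.toPath), fun h p ↦ h p.val⟩

lemma notMem_desc_iff_exists_walk : v ∉ desc T X w ↔ ∃ p : T.Walk X v, w ∉ p.support := by
  simp [mem_desc_iff_forall_walk]

lemma mem_desc_root : v ∈ desc T X X := fun p ↦ p.val.start_mem_support

lemma mem_desc_comm : v ∈ desc T X w ↔ X ∈ desc T v w := by
  simp only [mem_desc_iff_forall_walk]
  exact ⟨fun h p ↦ by simpa using h p.reverse, fun h p ↦ by simpa using h p.reverse⟩

lemma notMem_desc_trans (hu : u ∉ desc T X w) (hv : v ∉ desc T u w) : v ∉ desc T X w := by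
  rw [notMem_desc_iff_exists_walk] at *
  obtain ⟨p, hp⟩ := hu
  obtain ⟨q, hq⟩ := hv
  exact ⟨p.append q, by simp [SimpleGraph.Walk.mem_support_append_iff, hp, hq]⟩

lemma mem_desc_congr_root (hY : Y ∉ desc T X w) : v ∈ desc T X w ↔ v ∈ desc T Y w := by
  refine ⟨fun h ↦ ?_, fun h ↦ ?_⟩
  · by_contra hv
    exact notMem_desc_trans hY hv h
  · by_contra hv
    exact notMem_desc_trans (mem_desc_comm.not.mp hY) hv h

lemma SimpleGraph.Adj.notMem_desc (h : T.Adj u v) (hu : w ≠ u) (hv : w ≠ v) :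
    v ∉ desc T u w :=
  notMem_desc_iff_exists_walk.mpr ⟨h.toWalk, by simp [hu, hv]⟩

lemma notMem_desc_of_mem_desc (hw : v ∈ desc T X w) (hu : v ∉ desc T X u) :
    v ∉ desc T w u := by
  classical
  obtain ⟨p, hp⟩ := notMem_desc_iff_exists_walk.mp hu
  have hwp := mem_desc_iff_forall_walk.mp hw p
  exact notMem_desc_iff_exists_walk.mpr
    ⟨p.dropUntil w hwp, fun h ↦ hp (p.support_dropUntil_subset_support hwp h)⟩

lemma notMem_desc_of_mem_desc_of_ne (hT : T.Connected) (h : v ∈ desc T X u) (hne : v ≠ u) :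
    u ∉ desc T X v := by
  classical
  obtain ⟨p, hp⟩ := hT.exists_isPath X v
  have hu := h ⟨p, hp⟩
  exact notMem_desc_iff_exists_walk.mpr
    ⟨p.takeUntil u hu, SimpleGraph.Walk.endpoint_notMem_support_takeUntil hp hu hne⟩

lemma exists_adj_notMem_desc (hT : T.Connected) (hne : X ≠ w) :
    ∃ c, T.Adj w c ∧ c ∉ desc T X w := by
  obtain ⟨p, hp⟩ := hT.exists_isPath w X
  cases p with
  | nil => exact absurd rfl hne
  | cons h q =>
    exact ⟨_, h, mem_desc_comm.not.mp
      (notMem_desc_iff_exists_walk.mpr ⟨q, ((SimpleGraph.Walk.cons_isPath_iff _ _).mp hp).2⟩)⟩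

/-- In a tree, every edge is directed in exactly one way by each rooted orientation. -/
lemma SimpleGraph.IsTree.mem_desc_iff_notMem_desc (hT : T.IsTree) (h : T.Adj u v) :
    v ∈ desc T X u ↔ u ∉ desc T X v := by
  refine ⟨fun hv ↦ notMem_desc_of_mem_desc_of_ne hT.1 hv h.ne', fun hu p ↦ ?_⟩
  simp only [desc, Set.mem_ofPred_eq, not_forall] at hu
  obtain ⟨q, hq⟩ := hu
  exact hT.2.mem_support_of_ne_mem_support_of_adj_of_isPath p.2 q.2 h.symm hq

lemma SimpleGraph.IsTree.agreesOn_iff (hT : T.IsTree) (h : T.Adj u v) :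
    agreesOn T X Y s(u, v) ↔ (v ∈ desc T X u ↔ v ∈ desc T Y u) := by
  have hdir (Z a b : V) : rootedDir T Z a b ↔ T.Adj a b ∧ b ∈ desc T Z a := Iff.rfl
  refine ⟨fun hXY ↦ by simpa [hdir, h] using hXY u v rfl, fun hXY a b hab ↦ ?_⟩
  rcases Sym2.eq_iff.mp hab with ⟨rfl, rfl⟩ | ⟨rfl, rfl⟩
  · simp only [hdir, hXY]
  · simp only [hdir, hT.mem_desc_iff_notMem_desc h.symm, hXY]

lemma mem_desc_of_adj (hT : T.Connected) (hadj : T.Adj u v) (hne : w ≠ v)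
    (hX : v ∈ desc T X w) (hY : v ∈ desc T Y w) (hu : v ∈ desc T X u) : v ∈ desc T Y u := by
  by_cases hwu : w = u
  · exact hwu ▸ hY
  by_contra hv
  have hw : w ∈ desc T X u := by
    by_contra hw
    exact notMem_desc_trans hw (notMem_desc_of_mem_desc hY hv) hu
  exact notMem_desc_trans (notMem_desc_of_mem_desc_of_ne hT hw hwu)
    (hadj.notMem_desc hwu hne) hX

/-- A root whose orientation agrees with that of `X` around `w` equals `X` or lies in the same
component of `T - w` as `X`. -/
lemma SimpleGraph.IsTree.eq_or_notMem_desc_of_agreesOn (hT : T.IsTree)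
    (hY : ∀ c, T.Adj w c → agreesOn T X Y s(w, c)) : Y = X ∨ Y ∉ desc T X w := by
  by_cases hX : X = w
  · subst hX
    refine .inl (by_contra fun hne ↦ ?_)
    obtain ⟨c, hc, hcY⟩ := exists_adj_notMem_desc hT.1 hne
    exact hcY (((hT.agreesOn_iff hc).mp (hY c hc)).mp mem_desc_root)
  · obtain ⟨c, hc, hcX⟩ := exists_adj_notMem_desc hT.1 hX
    have hcY : c ∉ desc T Y w := ((hT.agreesOn_iff hc).mp (hY c hc)).not.mp hcX
    exact .inr (notMem_desc_trans hcX (mem_desc_comm.not.mp hcY))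

lemma SimpleGraph.IsTree.agreesOn_of_mem_desc (hT : T.IsTree) (hadj : T.Adj u v)
    (hv : v ∈ desc T X w) (hY : ∀ c, T.Adj w c → agreesOn T X Y s(w, c)) :
    agreesOn T X Y s(u, v) := by
  rcases hT.eq_or_notMem_desc_of_agreesOn hY with rfl | hXY
  · exact fun _ _ _ ↦ Iff.rfl
  by_cases hwv : w = v
  · rw [Sym2.eq_swap, ← hwv]
    exact hY u (hwv ▸ hadj.symm)
  have hvY := (mem_desc_congr_root hXY).mp hv
  exact (hT.agreesOn_iff hadj).mpr
    ⟨mem_desc_of_adj hT.1 hadj hwv hv hvY, mem_desc_of_adj hT.1 hadj hwv hvY hv⟩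

lemma SimpleGraph.IsTree.not_identified_singleton (hT : T.IsTree) (hadj : T.Adj u v)
    (hv : v ∉ desc T X w) (huv : v ∈ desc T X u) : ¬ identified T X {w} s(u, v) := by
  rintro ⟨-, h⟩
  refine notMem_desc_of_mem_desc_of_ne hT.1
    (((hT.agreesOn_iff hadj).mp (h v ?_)).mp huv) hadj.ne' mem_desc_root
  rintro e he ⟨_, rfl, hwe⟩
  obtain ⟨c, rfl⟩ := hwe
  exact (hT.agreesOn_iff he).mpr (mem_desc_congr_root hv)

end Descendants

/-- **Lemma 9 (appendix)**: In a finite tree `T` rooted at `X`, the set of edges identified by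
a singleton intervention `{w}` is exactly the set of edges of `T` having at least one endpoint
among the descendants `Desc_X(w)` of `w`. -/
theorem identified_singleton_eq_edges_incident_desc
    {V : Type*} [Fintype V] (T : SimpleGraph V) (hT : T.IsTree) (X w : V) :
    {e | identified T X {w} e} = {e ∈ T.edgeSet | ∃ v ∈ desc T X w, v ∈ e} := by
  ext e
  induction e with | h u v
  simp only [Set.mem_ofPred_eq]
  constructor
  · intro h
    have hadj : T.Adj u v := h.1
    refine ⟨hadj, ?_⟩
    by_contra! hdesc
    by_cases huv : v ∈ desc T X u
    · exact hT.not_identified_singleton hadj (fun hv ↦ hdesc v hv (by simp)) huv h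
    · exact hT.not_identified_singleton hadj.symm (fun hu ↦ hdesc u hu (by simp))
        ((hT.mem_desc_iff_notMem_desc hadj.symm).mpr huv) (Sym2.eq_swap ▸ h)
  · rintro ⟨hadj, x, hx, hxe⟩
    refine ⟨hadj, fun Y hY ↦ ?_⟩
    have hw (c : V) (hc : T.Adj w c) : agreesOn T X Y s(w, c) :=
      hY _ hc ⟨w, rfl, Sym2.mem_mk_left w c⟩
    rcases Sym2.mem_iff.mp hxe with rfl | rfl
    · exact Sym2.eq_swap ▸ hT.agreesOn_of_mem_desc (SimpleGraph.Adj.symm hadj) hx hw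
    · exact hT.agreesOn_of_mem_desc hadj hx hw
end

section
/- Let F be a finite forest whose connected components are trees T_1, …, T_R on disjoint vertex sets, with p_u = Σ_{r=1}^R |V(T_r)| total vertices, and let I be a subset of the vertices of F with |I| = k, I_r := I ∩ V(T_r). Then the average gain satisfies 𝒟(I) = (1/p_u) Σ_{r=1}^R |V(T_r)|² − k/p_u − (1/p_u) Σ_{r=1}^R Σ_{j=1}^{J(I_r)} |C_j(I_r)|², where C_1(I_r),…,C_{J(I_r)}(I_r) are the vertex sets of the connected components of the subgraph of T_r induced on V(T_r)∖I_r. -/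
open scoped BigOperators

section RootedTree

variable {V : Type*} {T : SimpleGraph V}

/-- If `T` rooted at `X` directs `u → v`, then every walk from `X` to `v` uses that edge. -/
theorem rootedDir.mem_edges (hT : T.IsTree) {X u v : V} (h : rootedDir T X u v)
    (w : T.Walk X v) : s(u, v) ∈ w.edges := by
  classical
  have hu : u ∈ (w.toPath : T.Walk X v).support := h.2 w.toPath
  have hdrop : (⟨_, w.toPath.2.dropUntil hu⟩ : T.Path u v) = SimpleGraph.Path.singleton h.1 :=
    (hT.isAcyclic.subsingleton_path u v).elim _ _
  refine w.edges_toPath_subset_edges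
    ((w.toPath : T.Walk X v).edges_dropUntil_subset_edges hu ?_)
  have hw := congrArg (fun p : T.Path u v => (p : T.Walk u v).edges) hdrop
  simp only at hw
  rw [hw]
  simp [SimpleGraph.Path.singleton]

theorem rootedDir.left_unique (hT : T.IsTree) {X u u' v : V} (h : rootedDir T X u v)
    (h' : rootedDir T X u' v) : u = u' := by
  obtain ⟨p, hp, -⟩ := hT.existsUnique_path X v
  have h₁ := h.mem_edges hT p
  have h₂ := h'.mem_edges hT p
  rw [Sym2.eq_swap] at h₁ h₂
  rw [hp.eq_penultimate_of_mem_edges h₁, hp.eq_penultimate_of_mem_edges h₂]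

theorem not_rootedDir_root {X u : V} : ¬ rootedDir T X u X := by
  intro h
  have := h.2 ⟨SimpleGraph.Walk.nil, SimpleGraph.Walk.IsPath.nil⟩
  simp only [SimpleGraph.Walk.support_nil, List.mem_singleton] at this
  exact h.1.ne this

theorem rootedDir_or_rootedDir (hT : T.IsTree) (X : V) {u v : V} (h : T.Adj u v) :
    rootedDir T X u v ∨ rootedDir T X v u := by
  obtain ⟨p, hp, -⟩ := hT.existsUnique_path X v
  by_cases hu : u ∈ p.support
  · refine Or.inl ⟨h, fun q => ?_⟩
    rwa [(hT.isAcyclic.subsingleton_path X v).elim q ⟨p, hp⟩]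
  · refine Or.inr ⟨h.symm, fun q => ?_⟩
    rw [(hT.isAcyclic.subsingleton_path X u).elim q ⟨_, hp.concat hu h.symm⟩]
    exact p.support_subset_support_concat _ p.end_mem_support

theorem rootedDir.asymm (hT : T.IsTree) {X u v : V} (h : rootedDir T X u v) :
    ¬ rootedDir T X v u := by
  classical
  intro h'
  obtain ⟨p, hp, -⟩ := hT.existsUnique_path X v
  have hu : u ∈ p.support := h.2 ⟨p, hp⟩
  exact SimpleGraph.Walk.endpoint_notMem_support_takeUntil hp hu h.1.ne' (h'.2 ⟨_, hp.takeUntil hu⟩)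

theorem rootedDir.mem_edges_of_not (hT : T.IsTree) {X Y u v : V} (h : rootedDir T X u v)
    (h' : ¬ rootedDir T Y u v) (w : T.Walk X Y) : s(u, v) ∈ w.edges := by
  have hq : ∃ q : T.Path Y v, u ∉ q.val.support := by
    by_contra! hq
    exact h' ⟨h.1, hq⟩
  obtain ⟨q, hq⟩ := hq
  have := h.mem_edges hT (w.append q.val)
  rw [SimpleGraph.Walk.edges_append, List.mem_append] at this
  exact this.resolve_right fun hmem => hq (q.val.fst_mem_support_of_mem_edges hmem)

/-- Rerooting from `X` to `Y` can only reverse edges lying on every walk from `X` to `Y`. -/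
theorem mem_edges_of_not_agreesOn (hT : T.IsTree) {X Y : V} {e : Sym2 V}
    (h : ¬ agreesOn T X Y e) (w : T.Walk X Y) : e ∈ w.edges := by
  simp only [agreesOn, not_forall] at h
  obtain ⟨u, v, rfl, h⟩ := h
  by_cases hX : rootedDir T X u v
  · exact hX.mem_edges_of_not hT (fun hY => h ⟨fun _ => hY, fun _ => hX⟩) w
  · have hY : rootedDir T Y u v := by
      by_contra hY
      exact h ⟨fun hX' => absurd hX' hX, fun hY' => absurd hY' hY⟩
    simpa using hY.mem_edges_of_not hT hX w.reverse

/-- Rerooting from `X` to `Y` reverses every edge of the path from `X` to `Y`. -/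
theorem not_agreesOn_of_mem_edges (hT : T.IsTree) {X Y : V} {p : T.Walk X Y} (hp : p.IsPath)
    {e : Sym2 V} (he : e ∈ p.edges) : ¬ agreesOn T X Y e := by
  classical
  intro h
  obtain ⟨u, v, rfl, huv⟩ : ∃ u v, e = s(u, v) ∧ rootedDir T X u v := by
    induction e using Sym2.ind with
    | _ u v =>
      rcases rootedDir_or_rootedDir hT X (p.adj_of_mem_edges he) with h' | h'
      · exact ⟨u, v, rfl, h'⟩
      · exact ⟨v, u, Sym2.eq_swap, h'⟩
  have hv := p.snd_mem_support_of_mem_edges he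
  have h₁ := huv.mem_edges hT (p.takeUntil v hv)
  have h₂ := ((h u v rfl).1 huv).mem_edges hT (p.dropUntil v hv).reverse
  rw [SimpleGraph.Walk.edges_reverse, List.mem_reverse] at h₂
  exact hp.isTrail.disjoint_edges_takeUntil_dropUntil hv h₁ h₂

/-- The roots whose orientation cannot be distinguished from that of `X` by looking only at the
edges incident to `I`. -/
theorem agreesOn_incident_iff (hT : T.IsTree) {X Y : V} {I : Set V} :
    (∀ e ∈ T.edgeSet, (∃ x ∈ I, x ∈ e) → agreesOn T X Y e) ↔ Y ∈ insert X (comp T I X) := by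
  constructor
  · intro h
    obtain ⟨p, hp, -⟩ := hT.existsUnique_path X Y
    by_cases hXY : Y = X
    · exact Or.inl hXY
    refine Or.inr ⟨p, fun u hu huI => ?_⟩
    obtain ⟨e, he, hue⟩ := (SimpleGraph.Walk.mem_support_iff_exists_mem_edges_of_not_nil
      (SimpleGraph.Walk.not_nil_of_ne (Ne.symm hXY))).1 hu
    exact not_agreesOn_of_mem_edges hT hp he (h e (p.edges_subset_edgeSet he) ⟨u, huI, hue⟩)
  · rintro (rfl | ⟨w, hw⟩) e - ⟨x, hxI, hxe⟩
    · exact fun _ _ _ => Iff.rfl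
    · by_contra h
      exact hw x (SimpleGraph.Walk.mem_support_of_mem_edges (mem_edges_of_not_agreesOn hT h w) hxe)
        hxI

theorem identified_iff (hT : T.IsTree) {X u v : V} (h : rootedDir T X u v) {I : Set V} :
    identified T X I s(u, v) ↔ v ∉ insert X (comp T I X) := by
  classical
  simp only [identified, agreesOn_incident_iff hT]
  constructor
  · rintro ⟨-, hid⟩ hv
    exact not_rootedDir_root ((hid v hv u v rfl).1 h)
  · refine fun hv => ⟨h.1, ?_⟩
    rintro Y (rfl | ⟨w, hw⟩)
    · exact fun _ _ _ => Iff.rfl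
    · by_contra hY
      have hvw := w.snd_mem_support_of_mem_edges (mem_edges_of_not_agreesOn hT hY w)
      exact hv (Or.inr ⟨w.takeUntil v hvw, fun x hx =>
        hw x (w.support_takeUntil_subset_support hvw hx)⟩)

theorem exists_rootedDir (hT : T.IsTree) {X v : V} (h : v ≠ X) : ∃ u, rootedDir T X u v := by
  obtain ⟨p, hp, -⟩ := hT.existsUnique_path X v
  have hnil : ¬ p.Nil := SimpleGraph.Walk.not_nil_of_ne h.symm
  refine ⟨p.penultimate, p.adj_penultimate hnil, fun q => ?_⟩
  rw [(hT.isAcyclic.subsingleton_path X v).elim q ⟨p, hp⟩]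
  exact p.fst_mem_support_of_mem_edges (p.mk_penultimate_end_mem_edges hnil)

theorem gain_add_ncard [Fintype V] (hT : T.IsTree) (X : V) (I : Set V) :
    gain T X I + (insert X (comp T I X)).ncard = Fintype.card V := by
  classical
  rw [← Nat.card_eq_fintype_card, ← Set.ncard_add_ncard_compl (insert X (comp T I X)), add_comm]
  congr 1
  have hne : ∀ v ∈ (insert X (comp T I X))ᶜ, v ≠ X := fun v hv hvX => hv (Or.inl hvX)
  have hpar : ∀ v ∈ (insert X (comp T I X))ᶜ, ∃ u, rootedDir T X u v :=
    fun v hv => exists_rootedDir hT (hne v hv)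
  choose par hpar using hpar
  refine (Set.ncard_congr (fun v hv => s(par v hv, v)) (fun v hv => ?_)
    (fun v v' hv hv' h => ?_) fun e he => ?_).symm
  · exact (identified_iff hT (hpar v hv)).2 hv
  · rcases Sym2.eq_iff.1 h with ⟨-, h⟩ | ⟨h₁, h₂⟩
    · exact h
    · have hd := hpar v hv
      have hd' := hpar v' hv'
      rw [← h₂, ← h₁] at hd'
      exact absurd hd' (hd.asymm hT)
  · obtain ⟨u, v, rfl, huv⟩ : ∃ u v, e = s(u, v) ∧ rootedDir T X u v := by
      induction e using Sym2.ind with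
      | _ u v =>
        rcases rootedDir_or_rootedDir hT X he.1 with h' | h'
        · exact ⟨u, v, rfl, h'⟩
        · exact ⟨v, u, Sym2.eq_swap, h'⟩
    have hv := (identified_iff hT huv).1 he
    exact ⟨v, hv, by rw [(hpar v hv).left_unique hT huv]⟩

end RootedTree

section Components

variable {V : Type*} {T : SimpleGraph V} {I : Set V}

theorem mem_comp_self {y : V} (hy : y ∉ I) : y ∈ comp T I y :=
  ⟨SimpleGraph.Walk.nil, by simpa using hy⟩

theorem comp_eq_empty {y : V} (hy : y ∈ I) : comp T I y = ∅ :=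
  Set.eq_empty_of_forall_notMem fun _ ⟨p, hp⟩ => hp y p.start_mem_support hy

theorem notMem_of_mem_comp {y z : V} (h : z ∈ comp T I y) : z ∉ I :=
  let ⟨p, hp⟩ := h
  hp z p.end_mem_support

theorem mem_comp_symm {y z : V} (h : z ∈ comp T I y) : y ∈ comp T I z :=
  let ⟨p, hp⟩ := h
  ⟨p.reverse, by simpa using hp⟩

theorem mem_comp_trans {x y z : V} (h : y ∈ comp T I x) (h' : z ∈ comp T I y) :
    z ∈ comp T I x := by
  obtain ⟨p, hp⟩ := h
  obtain ⟨q, hq⟩ := h'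
  refine ⟨p.append q, fun u hu => ?_⟩
  rcases (SimpleGraph.Walk.mem_support_append_iff _ _).1 hu with hu | hu
  exacts [hp u hu, hq u hu]

theorem comp_eq_iff {y z : V} (hz : z ∉ I) : comp T I z = comp T I y ↔ z ∈ comp T I y :=
  ⟨fun h => h ▸ mem_comp_self hz, fun h => Set.ext fun _ =>
    ⟨mem_comp_trans h, mem_comp_trans (mem_comp_symm h)⟩⟩

theorem finsum_ncard_comp_sq [Fintype V] :
    ∑ᶠ C ∈ {C : Set V | ∃ y : V, y ∉ I ∧ C = comp T I y}, (C.ncard : ℝ) ^ 2 =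
      ∑ X : V, ((comp T I X).ncard : ℝ) := by
  classical
  have hset : {C : Set V | ∃ y : V, y ∉ I ∧ C = comp T I y} =
      ((Finset.univ.filter (· ∉ I)).image (comp T I) : Finset (Set V)) := by
    ext C
    simp [eq_comm]
  rw [hset, finsum_mem_coe_finset]
  have hsum : ∑ X : V, ((comp T I X).ncard : ℝ) =
      ∑ X ∈ Finset.univ.filter (· ∉ I), ((comp T I X).ncard : ℝ) := by
    refine (Finset.sum_subset (Finset.subset_univ _) fun X _ hX => ?_).symm
    have hX : X ∈ I := by simpa using hX
    simp [comp_eq_empty hX]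
  rw [hsum, Finset.sum_comp (fun C : Set V => (C.ncard : ℝ))]
  refine Finset.sum_congr rfl fun C hC => ?_
  obtain ⟨y, -, rfl⟩ := Finset.mem_image.1 hC
  have hfib : comp T I y =
      ((Finset.univ.filter (· ∉ I)).filter fun a => comp T I a = comp T I y : Finset V) := by
    ext z
    simp only [Finset.coe_filter, Finset.mem_filter, Finset.mem_univ, true_and, Set.mem_ofPred_eq]
    exact ⟨fun h => ⟨notMem_of_mem_comp h, (comp_eq_iff (notMem_of_mem_comp h)).2 h⟩,
      fun h => (comp_eq_iff h.1).1 h.2⟩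
  rw [← Set.ncard_coe_finset, ← hfib, nsmul_eq_mul, sq]

theorem ncard_insert_comp [Fintype V] [DecidablePred (· ∈ I)] (X : V) :
    (insert X (comp T I X)).ncard = (comp T I X).ncard + if X ∈ I then 1 else 0 := by
  split_ifs with h
  · simp [comp_eq_empty h]
  · rw [Set.insert_eq_of_mem (mem_comp_self h), add_zero]

/-- The total gain over all roots of a single tree. -/
theorem sum_gain [Fintype V] (hT : T.IsTree) :
    ∑ X : V, (gain T X I : ℝ) = (Fintype.card V : ℝ) ^ 2 - I.ncard -
      ∑ᶠ C ∈ {C : Set V | ∃ y : V, y ∉ I ∧ C = comp T I y}, (C.ncard : ℝ) ^ 2 := by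
  classical
  have hgain : ∀ X : V, (gain T X I : ℝ) =
      Fintype.card V - ((comp T I X).ncard : ℝ) - if X ∈ I then 1 else 0 := by
    intro X
    have h := gain_add_ncard hT X I
    rw [ncard_insert_comp] at h
    rw [← h]
    push_cast
    ring
  have hI : ∑ X : V, (if X ∈ I then (1 : ℝ) else 0) = I.ncard := by
    rw [Finset.sum_boole, ← Set.ncard_coe_finset]
    simp
  simp only [hgain, Finset.sum_sub_distrib, hI, finsum_ncard_comp_sq]
  simp only [Finset.sum_const, Finset.card_univ, nsmul_eq_mul]
  ring

end Components

theorem Set.ncard_eq_sum_ncard_sigma_fiber {ι : Type*} [Fintype ι] {V : ι → Type*}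
    [∀ i, Fintype (V i)] (I : Set (Σ i, V i)) :
    I.ncard = ∑ i, {x : V i | (⟨i, x⟩ : Σ i, V i) ∈ I}.ncard := by
  classical
  have hI : I = (Finset.univ.sigma fun i =>
      Finset.univ.filter fun x : V i => (⟨i, x⟩ : Σ i, V i) ∈ I : Finset (Σ i, V i)) := by
    ext ⟨i, x⟩
    simp
  conv_lhs => rw [hI, Set.ncard_coe_finset, Finset.card_sigma]
  refine Finset.sum_congr rfl fun i _ => ?_
  rw [← Set.ncard_coe_finset]
  simp

/-- **Proposition 1**: For a forest with tree components `T 1, …, T R` on disjoint vertex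
sets, `p_u` total vertices, and a target set `I` of cardinality `k` with slices
`I_r = I ∩ V(T r)`, the average gain
`𝒟(I) = (1/p_u) ∑_r ∑_{X ∈ V(T r)} D(I_r, T_r^X)` satisfies
`𝒟(I) = (1/p_u) ∑_r |V(T r)|² − k/p_u − (1/p_u) ∑_r ∑_j |C_j(I_r)|²`,
where the `C_j(I_r)` are the connected components of the subgraph of `T r` induced on
`V(T r) ∖ I_r`. -/
theorem avgGain_tree_formula
    {R : ℕ} (V : Fin R → Type*) [∀ r, Fintype (V r)]
    (T : ∀ r, SimpleGraph (V r)) (hT : ∀ r, (T r).IsTree)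
    (p_u : ℕ) (hp : p_u = ∑ r, Fintype.card (V r))
    (I : Set (Σ r, V r)) (k : ℕ) (hk : I.ncard = k) :
    (1 / (p_u : ℝ)) *
        ∑ r, ∑ X : V r, (gain (T r) X {x : V r | (⟨r, x⟩ : Σ r, V r) ∈ I} : ℝ) =
      (1 / (p_u : ℝ)) * ∑ r, (Fintype.card (V r) : ℝ) ^ 2 - (k : ℝ) / (p_u : ℝ) -
        (1 / (p_u : ℝ)) *
          ∑ r, ∑ᶠ C ∈ {C : Set (V r) | ∃ y : V r,
              y ∉ {x : V r | (⟨r, x⟩ : Σ r, V r) ∈ I} ∧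
              C = comp (T r) {x : V r | (⟨r, x⟩ : Σ r, V r) ∈ I} y},
            ((C.ncard : ℝ)) ^ 2 := by
  have hk' : (k : ℝ) = ∑ r, ({x : V r | (⟨r, x⟩ : Σ r, V r) ∈ I}.ncard : ℝ) := by
    rw [← hk, Set.ncard_eq_sum_ncard_sigma_fiber]
    push_cast
    rfl
  simp only [sum_gain (hT _), Finset.sum_sub_distrib, ← hk']
  ring
end

section
/- Let F be a finite forest whose connected components are trees T_1, …, T_R on disjoint vertex sets with p_u total vertices. Then the average gain 𝒟, viewed as a set function on subsets of the vertex set of F, is monotonically increasing (I₁ ⊆ I₂ implies 𝒟(I₁) ≤ 𝒟(I₂)) and submodular (for all I₁ ⊆ I₂ and every vertex x, 𝒟(I₁ ∪ {x}) − 𝒟(I₁) ≥ 𝒟(I₂ ∪ {x}) − 𝒟(I₂)). -/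
open scoped BigOperators

/-- The average gain `𝒟(I)` of a target set `I` in a forest with tree components
`T 1, …, T R` (on disjoint vertex sets, with `p_u` total vertices):
`𝒟(I) = (1/p_u) ∑_r ∑_{X ∈ V(T r)} D(I_r, T_r^X)` where `I_r = I ∩ V(T r)`. -/
noncomputable def avgGain {R : ℕ} (V : Fin R → Type*) [∀ r, Fintype (V r)]
    (T : ∀ r, SimpleGraph (V r)) (I : Set (Σ r, V r)) : ℝ :=
  (1 / ((∑ r, Fintype.card (V r) : ℕ) : ℝ)) *
    ∑ r, ∑ X : V r, (gain (T r) X {x : V r | (⟨r, x⟩ : Σ r, V r) ∈ I} : ℝ)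

namespace SimpleGraph

variable {V : Type*} {T : SimpleGraph V}

lemma IsAcyclic.mem_edges_iff_not_reachable_deleteEdges (hT : T.IsAcyclic) {X Y : V}
    {p : T.Walk X Y} (hp : p.IsPath) (e : Sym2 V) :
    e ∈ p.edges ↔ ¬ (T.deleteEdges {e}).Reachable X Y := by
  constructor
  · rintro he ⟨w⟩
    classical
    have hle : T.deleteEdges {e} ≤ T := deleteEdges_le _
    have hpath : (w.toPath.val.mapLe hle).IsPath := w.toPath.property.mapLe hle
    have heq : p = w.toPath.val.mapLe hle :=
      congrArg Subtype.val ((hT.subsingleton_path _ _).elim ⟨p, hp⟩ ⟨_, hpath⟩)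
    rw [heq, Walk.edges_mapLe_eq_edges] at he
    simpa using Walk.edges_subset_edgeSet _ he
  · intro h
    by_contra he
    exact h ⟨p.toDeleteEdge e he⟩

lemma IsTree.rootedDir_iff (hT : T.IsTree) (X u v : V) :
    rootedDir T X u v ↔ T.Adj u v ∧ ¬ (T.deleteEdges {s(u, v)}).Reachable X v := by
  classical
  refine and_congr_right fun huv => ?_
  obtain ⟨p, hp⟩ := hT.connected.exists_isPath X v
  rw [← hT.isAcyclic.mem_edges_iff_not_reachable_deleteEdges hp]
  constructor
  · intro h
    have hu : u ∈ p.support := h ⟨p, hp⟩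
    have heq : p.dropUntil u hu = huv.toWalk := congrArg Subtype.val
      ((hT.isAcyclic.subsingleton_path _ _).elim ⟨_, hp.dropUntil hu⟩ (Path.singleton huv))
    apply p.edges_dropUntil_subset_edges hu
    simp [heq]
  · intro he q
    rw [(hT.isAcyclic.subsingleton_path _ _).elim q ⟨p, hp⟩]
    exact p.fst_mem_support_of_mem_edges he

lemma Connected.reachable_deleteEdges_or (hT : T.Connected) (X u v : V) :
    (T.deleteEdges {s(u, v)}).Reachable X u ∨ (T.deleteEdges {s(u, v)}).Reachable X v := by
  classical
  obtain ⟨p, hp⟩ := hT.exists_isPath X u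
  by_cases he : s(u, v) ∈ p.edges
  · have hv : v ∈ p.support := p.snd_mem_support_of_mem_edges he
    refine Or.inr ⟨(p.takeUntil v hv).toDeleteEdge _ fun h => ?_⟩
    exact Walk.endpoint_notMem_support_takeUntil hp hv (p.adj_of_mem_edges he).ne
      (Walk.fst_mem_support_of_mem_edges _ h)
  · exact Or.inl ⟨p.toDeleteEdge _ he⟩

lemma IsTree.agreesOn_iff_s5 (hT : T.IsTree) (X Y : V) {e : Sym2 V} (he : e ∈ T.edgeSet) :
    agreesOn T X Y e ↔ (T.deleteEdges {e}).Reachable X Y := by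
  constructor
  · intro h
    induction e with | _ u v
    have huv : T.Adj u v := he
    have hv := h u v rfl
    have hu := h v u Sym2.eq_swap
    rw [hT.rootedDir_iff, hT.rootedDir_iff] at hu hv
    rw [Sym2.eq_swap] at hu
    simp only [huv, huv.symm, true_and, not_iff_not] at hu hv
    rcases hT.connected.reachable_deleteEdges_or X u v with hX | hX
    · exact hX.trans (hu.mp hX).symm
    · exact hX.trans (hv.mp hX).symm
  · rintro h u v rfl
    rw [hT.rootedDir_iff, hT.rootedDir_iff]
    refine and_congr_right fun _ => not_congr ⟨h.symm.trans, h.trans⟩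

/-- Each edge is identified, with respect to a fixed root, exactly by the target sets that meet
the path from the root to the far endpoint of the edge. -/
lemma IsTree.exists_identified_iff_inter_nonempty (hT : T.IsTree) (X : V) {e : Sym2 V}
    (he : e ∈ T.edgeSet) :
    ∃ S : Set V, ∀ I : Set V, identified T X I e ↔ (S ∩ I).Nonempty := by
  classical
  have agrees_iff {Y : V} {q : T.Walk X Y} (hq : q.IsPath) {e' : Sym2 V} (he' : e' ∈ T.edgeSet) :
      agreesOn T X Y e' ↔ e' ∉ q.edges := by
    rw [hT.agreesOn_iff_s5 X Y he', hT.isAcyclic.mem_edges_iff_not_reachable_deleteEdges hq, not_not]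
  obtain ⟨v, hve, hv⟩ : ∃ v ∈ e, ¬ (T.deleteEdges {e}).Reachable X v := by
    induction e with | _ u v
    by_contra! h
    have hb := isAcyclic_iff_forall_adj_isBridge.mp hT.isAcyclic he
    rw [isBridge_iff] at hb
    exact hb ((h u (by simp)).symm.trans (h v (by simp)))
  obtain ⟨p, hp⟩ := hT.connected.exists_isPath X v
  rw [← hT.isAcyclic.mem_edges_iff_not_reachable_deleteEdges hp] at hv
  refine ⟨{w | w ∈ p.support}, fun I => ⟨fun h => ?_, ?_⟩⟩
  · by_contra hI
    refine (agrees_iff hp he).mp (h.2 v ?_) hv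
    rintro e' he' ⟨x, hxI, hxe⟩
    rw [agrees_iff hp he']
    exact fun h' => hI ⟨x, p.mem_support_of_mem_edges h' hxe, hxI⟩
  · rintro ⟨w, hwp, hwI⟩
    refine ⟨he, fun Y hY => ?_⟩
    obtain ⟨q, hq⟩ := hT.connected.exists_isPath X Y
    rw [agrees_iff hq he]
    intro heq
    have hvq : v ∈ q.support := q.mem_support_of_mem_edges heq hve
    have hpq : p = q.takeUntil v hvq := congrArg Subtype.val
      ((hT.isAcyclic.subsingleton_path _ _).elim ⟨p, hp⟩ ⟨_, hq.takeUntil hvq⟩)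
    have hwq : w ∈ q.support := q.support_takeUntil_subset_support hvq (hpq ▸ hwp)
    have hnil : ¬ q.Nil := fun h => by simp [Walk.edges_eq_nil.mpr h] at heq
    obtain ⟨e', he', hwe'⟩ := (Walk.mem_support_iff_exists_mem_edges_of_not_nil hnil).mp hwq
    exact (agrees_iff hq (q.edges_subset_edgeSet he')).mp
      (hY e' (q.edges_subset_edgeSet he') ⟨w, hwI, hwe'⟩) he'

lemma IsTree.identified_mono (hT : T.IsTree) (X : V) {I J : Set V} (hIJ : I ⊆ J) :
    {e | identified T X I e} ⊆ {e | identified T X J e} := by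
  intro e he
  obtain ⟨S, hS⟩ := hT.exists_identified_iff_inter_nonempty X he.1
  exact (hS J).mpr (((hS I).mp he).mono (Set.inter_subset_inter_right S hIJ))

lemma IsTree.setOf_identified_union (hT : T.IsTree) (X : V) (I J : Set V) :
    {e | identified T X (I ∪ J) e} = {e | identified T X J e} ∪ {e | identified T X I e} := by
  refine Set.Subset.antisymm (fun e he => ?_) (Set.union_subset
    (hT.identified_mono X Set.subset_union_right) (hT.identified_mono X Set.subset_union_left))
  obtain ⟨S, hS⟩ := hT.exists_identified_iff_inter_nonempty X he.1
  have h := (hS _).mp he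
  rw [Set.inter_union_distrib_left, Set.union_nonempty] at h
  exact h.symm.imp (hS J).mpr (hS I).mpr

lemma IsTree.gain_mono [Finite V] (hT : T.IsTree) (X : V) {I J : Set V} (hIJ : I ⊆ J) :
    gain T X I ≤ gain T X J :=
  Set.ncard_le_ncard (hT.identified_mono X hIJ) (Set.toFinite _)

lemma IsTree.gain_submodular [Finite V] (hT : T.IsTree) (X : V) {I₁ I₂ : Set V} (h : I₁ ⊆ I₂)
    (J : Set V) :
    gain T X (I₂ ∪ J) + gain T X I₁ ≤ gain T X (I₁ ∪ J) + gain T X I₂ := by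
  have hunion (I : Set V) : gain T X (I ∪ J) =
      ({e | identified T X J e} \ {e | identified T X I e}).ncard + gain T X I := by
    rw [gain, hT.setOf_identified_union, gain, Set.ncard_sdiff_add_ncard _ _]
  have hle := Set.ncard_le_ncard (Set.sdiff_subset_sdiff_right (s := {e | identified T X J e})
    (hT.identified_mono X h)) (Set.toFinite _)
  rw [hunion, hunion]
  omega

end SimpleGraph

/-- **Proposition 2**: For a finite forest, the average gain `𝒟` is a monotonically
increasing and submodular set function on subsets of the vertex set. -/
theorem avgGain_monotone_submodular
    {R : ℕ} (V : Fin R → Type*) [∀ r, Fintype (V r)]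
    (T : ∀ r, SimpleGraph (V r)) (hT : ∀ r, (T r).IsTree) :
    (∀ I₁ I₂ : Set (Σ r, V r), I₁ ⊆ I₂ → avgGain V T I₁ ≤ avgGain V T I₂) ∧
    (∀ I₁ I₂ : Set (Σ r, V r), I₁ ⊆ I₂ → ∀ x : Σ r, V r,
      avgGain V T (I₁ ∪ {x}) - avgGain V T I₁ ≥ avgGain V T (I₂ ∪ {x}) - avgGain V T I₂) := by
  refine ⟨fun I₁ I₂ h => ?_, fun I₁ I₂ h x => ?_⟩
  · unfold avgGain
    gcongr with r _ X _
    exact (hT r).gain_mono X fun _ hx => h hx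
  · unfold avgGain
    simp only [ge_iff_le, ← mul_sub, ← Finset.sum_sub_distrib]
    refine mul_le_mul_of_nonneg_left
      (Finset.sum_le_sum fun r _ => Finset.sum_le_sum fun X _ => ?_) (by positivity)
    have hsub := (hT r).gain_submodular X (I₁ := {y | ⟨r, y⟩ ∈ I₁}) (I₂ := {y | ⟨r, y⟩ ∈ I₂})
      (fun _ hy => h hy) {y | ⟨r, y⟩ ∈ ({x} : Set (Σ r, V r))}
    rw [sub_le_sub_iff]
    exact_mod_cast hsub
end

section
/- Let T be a finite tree with vertex set V of cardinality n, and let X ∈ V. Then the set function I ↦ D(I, T^X) on subsets of V is monotonically increasing (I₁ ⊆ I₂ implies D(I₁, T^X) ≤ D(I₂, T^X)) and submodular (for all I₁ ⊆ I₂ ⊆ V and every vertex x ∈ V, D(I₁ ∪ {x}, T^X) − D(I₁, T^X) ≥ D(I₂ ∪ {x}, T^X) − D(I₂, T^X)). -/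
/-- In an acyclic graph, the endpoints of an edge are separated by deleting that edge. -/
theorem not_reachable_deleteEdges_of_adj {V : Type*} {T : SimpleGraph V} (hT : T.IsAcyclic)
    {u v : V} (h : T.Adj u v) : ¬ (T.deleteEdges {s(u, v)}).Reachable u v :=
  SimpleGraph.isBridge_iff.mp (SimpleGraph.isAcyclic_iff_forall_adj_isBridge.mp hT h)

theorem rootedDir_iff_reachable {V : Type*} {T : SimpleGraph V} (hT : T.IsTree) {X u v : V}
    (h : T.Adj u v) : rootedDir T X u v ↔ (T.deleteEdges {s(u, v)}).Reachable X u := by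
  classical
  constructor
  · rintro ⟨-, hp⟩
    obtain ⟨p, hpath⟩ := hT.connected.exists_isPath X v
    have hu : u ∈ p.support := hp ⟨p, hpath⟩
    refine ⟨(p.takeUntil u hu).toDeleteEdge _ fun he => ?_⟩
    exact SimpleGraph.Walk.endpoint_notMem_support_takeUntil hpath hu h.ne'
      (SimpleGraph.Walk.snd_mem_support_of_mem_edges _ he)
  · refine fun hr => ⟨h, fun p => ?_⟩
    by_contra hu
    refine not_reachable_deleteEdges_of_adj hT.isAcyclic h
      (hr.symm.trans ⟨p.val.toDeleteEdge _ fun he => hu ?_⟩)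
    exact SimpleGraph.Walk.fst_mem_support_of_mem_edges _ he

theorem reachable_deleteEdges_or {V : Type*} {T : SimpleGraph V} (hT : T.IsTree) (X : V) {u v : V}
    (h : T.Adj u v) : (T.deleteEdges {s(u, v)}).Reachable X u ∨
      (T.deleteEdges {s(u, v)}).Reachable X v := by
  by_cases hd : rootedDir T X u v
  · exact Or.inl ((rootedDir_iff_reachable hT h).mp hd)
  · obtain ⟨p, hp⟩ : ∃ p : T.Path X v, u ∉ p.val.support := by
      simpa [rootedDir, h] using hd
    exact Or.inr ⟨p.val.toDeleteEdge _ fun he =>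
      hp (SimpleGraph.Walk.fst_mem_support_of_mem_edges _ he)⟩

/-- Two rooted orientations agree on an edge exactly when the roots lie on the same side of it. -/
theorem agreesOn_iff_reachable {V : Type*} {T : SimpleGraph V} (hT : T.IsTree) {X Y : V}
    {e : Sym2 V} (he : e ∈ T.edgeSet) :
    agreesOn T X Y e ↔ (T.deleteEdges {e}).Reachable X Y := by
  constructor
  · induction e using Sym2.ind with | _ u v =>
    intro hagree
    have hadj : T.Adj u v := he
    rcases reachable_deleteEdges_or hT X hadj with hr | hr
    · have hY := (hagree u v rfl).mp ((rootedDir_iff_reachable hT hadj).mpr hr)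
      exact hr.trans ((rootedDir_iff_reachable hT hadj).mp hY).symm
    · rw [Sym2.eq_swap] at hr ⊢
      have hY := (hagree v u Sym2.eq_swap).mp ((rootedDir_iff_reachable hT hadj.symm).mpr hr)
      exact hr.trans ((rootedDir_iff_reachable hT hadj.symm).mp hY).symm
  · rintro hr u v rfl
    rw [rootedDir_iff_reachable hT he, rootedDir_iff_reachable hT he]
    exact ⟨hr.symm.trans, hr.trans⟩

/-- If the `X`- and `Y`-rooted orientations differ on `e`, then the endpoint of `e` far from `X`
differs from `X` on `e`, and agrees with `X` wherever `Y` does. -/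
theorem exists_far_endpoint {V : Type*} {T : SimpleGraph V} (hT : T.IsTree) (X : V)
    {e : Sym2 V} (he : e ∈ T.edgeSet) :
    ∃ w : V, ¬ agreesOn T X w e ∧ ∀ Y : V, ¬ agreesOn T X Y e →
      ∀ e' ∈ T.edgeSet, agreesOn T X Y e' → agreesOn T X w e' := by
  classical
  obtain ⟨w, hwe, hw⟩ : ∃ w ∈ e, ¬ (T.deleteEdges {e}).Reachable X w := by
    induction e using Sym2.ind with | _ u v =>
    by_contra! hc
    exact not_reachable_deleteEdges_of_adj hT.isAcyclic he
      ((hc u (Sym2.mem_mk_left u v)).symm.trans (hc v (Sym2.mem_mk_right u v)))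
  refine ⟨w, by rwa [agreesOn_iff_reachable hT he], fun Y hY e' he' hagree => ?_⟩
  rw [agreesOn_iff_reachable hT he] at hY
  rw [agreesOn_iff_reachable hT he'] at hagree ⊢
  obtain ⟨p⟩ := hagree
  have hmem : e ∈ p.edges := by
    by_contra hne
    refine hY ⟨(p.mapLe (T.deleteEdges_le {e'})).toDeleteEdge e ?_⟩
    simpa using hne
  exact ⟨p.takeUntil w (p.mem_support_of_mem_edges hmem hwe)⟩

theorem identified_mono {V : Type*} {T : SimpleGraph V} {X : V} {I J : Set V} (hIJ : I ⊆ J)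
    {e : Sym2 V} (h : identified T X I e) : identified T X J e :=
  ⟨h.1, fun Y hY => h.2 Y fun e' he' ⟨x, hx, hxe⟩ => hY e' he' ⟨x, hIJ hx, hxe⟩⟩

theorem identified_union_iff {V : Type*} {T : SimpleGraph V} (hT : T.IsTree) {X : V}
    {I J : Set V} {e : Sym2 V} :
    identified T X (I ∪ J) e ↔ identified T X I e ∨ identified T X J e := by
  refine ⟨fun h => ?_, fun h => h.elim (identified_mono Set.subset_union_left)
    (identified_mono Set.subset_union_right)⟩
  obtain ⟨w, hw, hfar⟩ := exists_far_endpoint hT X h.1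
  by_contra! hc
  obtain ⟨hI, hJ⟩ := hc
  simp only [identified, h.1, true_and] at hI hJ
  push Not at hI hJ
  obtain ⟨Y, hY, hYe⟩ := hI
  obtain ⟨Z, hZ, hZe⟩ := hJ
  refine hw (h.2 w ?_)
  rintro e' he' ⟨x, hx | hx, hxe⟩
  · exact hfar Y hYe e' he' (hY e' he' ⟨x, hx, hxe⟩)
  · exact hfar Z hZe e' he' (hZ e' he' ⟨x, hx, hxe⟩)

theorem ncard_union_add_ncard_le {α : Type*} [Finite α] {A B : Set α} (hAB : A ⊆ B) (C : Set α) :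
    (B ∪ C).ncard + A.ncard ≤ (A ∪ C).ncard + B.ncard := by
  have h := Set.ncard_union_add_ncard_inter (A ∪ C) B
  rw [Set.union_right_comm, Set.union_eq_self_of_subset_left hAB] at h
  have hA : A.ncard ≤ ((A ∪ C) ∩ B).ncard :=
    Set.ncard_le_ncard (Set.subset_inter Set.subset_union_left hAB)
  omega


/-- For a finite tree `T` rooted at `X`, the gain `I ↦ D(I, T^X)` is a monotonically
increasing and submodular set function (intermediate claim in the proof of Proposition 2). -/
theorem gain_monotone_submodular
    {V : Type*} [Fintype V] (T : SimpleGraph V) (hT : T.IsTree) (X : V) :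
    (∀ I₁ I₂ : Set V, I₁ ⊆ I₂ → gain T X I₁ ≤ gain T X I₂) ∧
    (∀ I₁ I₂ : Set V, I₁ ⊆ I₂ → ∀ x : V,
      (gain T X (I₁ ∪ {x}) : ℤ) - (gain T X I₁ : ℤ) ≥
        (gain T X (I₂ ∪ {x}) : ℤ) - (gain T X I₂ : ℤ)) := by
  have hunion : ∀ I J : Set V, {e | identified T X (I ∪ J) e} =
      {e | identified T X I e} ∪ {e | identified T X J e} :=
    fun I J => Set.ext fun e => identified_union_iff hT
  refine ⟨fun I₁ I₂ h => Set.ncard_le_ncard fun e => identified_mono h, fun I₁ I₂ h x => ?_⟩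
  have hsub : {e | identified T X I₁ e} ⊆ {e | identified T X I₂ e} := fun e => identified_mono h
  have key := ncard_union_add_ncard_le hsub {e | identified T X {x} e}
  rw [← hunion, ← hunion] at key
  simp only [gain]
  omega
end

section
/- Let V be a finite set, k ≥ 1 an integer, ε ≥ 0, and let f be a real-valued set function on subsets of V that is monotonically increasing, submodular, and satisfies f(∅) = 0. Let I* ⊆ V with |I*| = k be a maximizer of f over all subsets of V of cardinality k. Suppose ∅ = I₀ ⊆ I₁ ⊆ ⋯ ⊆ I_k is a chain of subsets of V with |I_i| = i for each i, such that for every 0 ≤ i < k and every x ∈ V, f(I_i ∪ {x}) − f(I_i) ≤ (f(I_{i+1}) − f(I_i)) + 4ε·f(I*). Then f(I_k) ≥ (1 − 1/e − 4εk)·f(I*). -/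
/-- For a submodular set function, uniformly bounded marginal gains at `A` bound the gain of
adding a finite set to `A`. -/
theorem le_add_ncard_mul_of_marginal_le {V : Type*} {f : Set V → ℝ}
    (hsub : ∀ A B : Set V, A ⊆ B → ∀ x : V, f (A ∪ {x}) - f A ≥ f (B ∪ {x}) - f B)
    {A : Set V} {c : ℝ} (hc : ∀ x : V, f (A ∪ {x}) - f A ≤ c) {S : Set V} (hS : S.Finite) :
    f (A ∪ S) ≤ f A + S.ncard * c := by
  induction S, hS using Set.Finite.induction_on with
  | empty => simp
  | @insert a S ha hS ih =>
    have hstep := hsub A (A ∪ S) Set.subset_union_left a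
    have hunion : A ∪ insert a S = A ∪ S ∪ {a} := by
      rw [Set.union_assoc, Set.union_singleton (s := S)]
    rw [Set.ncard_insert_of_notMem ha hS, hunion]
    push_cast
    linarith [hc a]

/-- Unrolling a linear recurrence inequality with contraction factor `r ∈ [0, 1]` and
additive error `η`. -/
theorem le_pow_mul_add_of_recurrence {g : ℕ → ℝ} {r η : ℝ} (hr0 : 0 ≤ r) (hr1 : r ≤ 1)
    (hη : 0 ≤ η) {k : ℕ} (hg : ∀ i < k, g (i + 1) ≤ r * g i + η) :
    ∀ i ≤ k, g i ≤ r ^ i * g 0 + i * η := by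
  intro i hi
  induction i with
  | zero => simp
  | succ i ih =>
    calc g (i + 1) ≤ r * g i + η := hg i hi
      _ ≤ r * (r ^ i * g 0 + i * η) + η := by gcongr; exact ih (by omega)
      _ = r ^ (i + 1) * g 0 + r * (i * η) + η := by ring
      _ ≤ r ^ (i + 1) * g 0 + 1 * (i * η) + η := by gcongr
      _ = r ^ (i + 1) * g 0 + (i + 1 : ℕ) * η := by push_cast; ring

/-- **Deterministic core of Theorem 5**: Let `f` be a monotonically increasing, submodular
set function on subsets of a finite set `V` with `f ∅ = 0`, let `I*` be a maximizer of `f`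
over subsets of cardinality `k`, and let `∅ = I₀ ⊆ I₁ ⊆ ⋯ ⊆ I_k` be a chain with `|I_i| = i`
such that each step selects an element whose marginal gain is within an additive error
`4·ε·f(I*)` of the best marginal gain.  Then `f(I_k) ≥ (1 − 1/e − 4·ε·k)·f(I*)`. -/
theorem approx_greedy_guarantee
    {V : Type*} [Fintype V] (k : ℕ) (hk : 1 ≤ k) (ε : ℝ) (hε : 0 ≤ ε)
    (f : Set V → ℝ)
    (hmono : ∀ A B : Set V, A ⊆ B → f A ≤ f B)
    (hsub : ∀ A B : Set V, A ⊆ B → ∀ x : V,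
      f (A ∪ {x}) - f A ≥ f (B ∪ {x}) - f B)
    (hf0 : f ∅ = 0)
    (Istar : Set V) (hIstar_card : Istar.ncard = k)
    (hIstar_opt : ∀ S : Set V, S.ncard = k → f S ≤ f Istar)
    (I : ℕ → Set V) (hI0 : I 0 = ∅)
    (hchain : ∀ i < k, I i ⊆ I (i + 1))
    (hcard : ∀ i ≤ k, (I i).ncard = i)
    (hgreedy : ∀ i < k, ∀ x : V,
      f (I i ∪ {x}) - f (I i) ≤ (f (I (i + 1)) - f (I i)) + 4 * ε * f Istar) :
    f (I k) ≥ (1 - 1 / Real.exp 1 - 4 * ε * k) * f Istar := by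
  have hF : 0 ≤ f Istar := hf0 ▸ hmono ∅ Istar (Set.empty_subset _)
  have hη : 0 ≤ 4 * ε * f Istar := by positivity
  have hk1 : (1 : ℝ) ≤ k := by exact_mod_cast hk
  have hk0 : (0 : ℝ) < k := by linarith
  have hinv : 1 / (k : ℝ) ≤ 1 := (div_le_one hk0).2 hk1
  have hrec : ∀ i < k, f Istar - f (I (i + 1)) ≤
      (1 - 1 / (k : ℝ)) * (f Istar - f (I i)) + 4 * ε * f Istar := by
    intro i hi
    have hunion := le_add_ncard_mul_of_marginal_le hsub (hgreedy i hi) Istar.toFinite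
    rw [hIstar_card] at hunion
    have hle := hmono Istar (I i ∪ Istar) Set.subset_union_right
    have hgap : 1 / (k : ℝ) * (f Istar - f (I i)) ≤
        f (I (i + 1)) - f (I i) + 4 * ε * f Istar := by
      rw [one_div_mul_eq_div, div_le_iff₀' hk0]
      linarith
    linarith
  have hfinal := le_pow_mul_add_of_recurrence (g := fun i => f Istar - f (I i))
    (sub_nonneg.2 hinv) (sub_le_self _ (by positivity)) hη hrec k le_rfl
  have hexp : (1 - 1 / (k : ℝ)) ^ k ≤ 1 / Real.exp 1 := by
    rw [one_div (Real.exp 1), ← Real.exp_neg]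
    exact Real.one_sub_div_pow_le_exp_neg hk1
  simp only [hI0, hf0, sub_zero] at hfinal
  linarith [mul_le_mul_of_nonneg_right hexp hF]
end

section
/- Let G be a finite simple graph that is chordal, i.e., every cycle of G of length at least 4 has a chord (an edge of G joining two non-consecutive vertices of the cycle). Let r be an orientation of G: a relation on the vertices such that for all u, v, G.Adj u v ↔ (r u v ∨ r v u) and ¬(r u v ∧ r v u). If r has a directed cycle (a sequence v_0, v_1, …, v_m = v_0 of vertices, distinct except for the endpoints, with m ≥ 3 and r v_i v_{i+1} for all 0 ≤ i < m), then r has a directed cycle of length 3, i.e., there exist vertices a, b, c with r a b, r b c, and r c a. -/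
namespace SimpleGraph

variable {V : Type*} {G : SimpleGraph V}

/-- A sequence of successively adjacent vertices can be packaged as a walk. -/
theorem exists_walk_of_forall_adj (w : ℕ → V) (n : ℕ) (h : ∀ i < n, G.Adj (w i) (w (i + 1))) :
    ∃ p : G.Walk (w 0) (w n), p.support = (List.range (n + 1)).map w ∧
      p.edges = (List.range n).map fun i => s(w i, w (i + 1)) := by
  induction n with
  | zero => exact ⟨Walk.nil, by simp, by simp⟩
  | succ n ih =>
    obtain ⟨p, hs, he⟩ := ih fun i hi => h i (by omega)
    refine ⟨p.concat (h n (by omega)), ?_, ?_⟩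
    · rw [Walk.support_concat, hs, List.range_succ (n := n + 1)]
      simp
    · rw [Walk.edges_concat, he, List.range_succ]
      simp

/-- In a chordal graph, a cyclic sequence of at least four distinct vertices has two
non-consecutive terms that are adjacent. -/
theorem exists_chord_of_cyclic_sequence
    (hchordal : ∀ (v : V) (p : G.Walk v v), p.IsCycle → 4 ≤ p.length →
      ∃ a b : V, G.Adj a b ∧ a ∈ p.support ∧ b ∈ p.support ∧ s(a, b) ∉ p.edges)
    {n : ℕ} (hn : 3 ≤ n) (w : ℕ → V) (hinj : ∀ i ≤ n, ∀ j ≤ n, w i = w j → i = j)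
    (hadj : ∀ i < n, G.Adj (w i) (w (i + 1))) (hclose : G.Adj (w n) (w 0)) :
    ∃ i j, i + 2 ≤ j ∧ j ≤ n ∧ (i = 0 → j ≠ n) ∧ G.Adj (w i) (w j) := by
  obtain ⟨p, hs, he⟩ := exists_walk_of_forall_adj w n hadj
  have hpath : p.IsPath := by
    rw [Walk.isPath_def, hs]
    refine List.Nodup.map_on (fun i hi j hj => ?_) List.nodup_range
    exact hinj i (by grind) j (by grind)
  have hnotin : s(w n, w 0) ∉ p.edges := by
    rw [he, List.mem_map]
    rintro ⟨k, hk, hkn⟩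
    have hk := List.mem_range.mp hk
    rcases Sym2.eq_iff.mp hkn with ⟨h1, -⟩ | ⟨h1, h2⟩
    · have := hinj k (by omega) n le_rfl h1
      omega
    · have := hinj k (by omega) 0 (by omega) h1
      have := hinj (k + 1) (by omega) n le_rfl h2
      omega
  have hlen : (Walk.cons hclose p).length = n + 1 := by
    rw [Walk.length_cons, ← Walk.length_edges, he, List.length_map, List.length_range]
  obtain ⟨a, b, hab, ha, hb, hne⟩ := hchordal _ (Walk.cons hclose p)
    ((Walk.cons_isCycle_iff p hclose).mpr ⟨hpath, hnotin⟩) (by omega)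
  have hmem : ∀ x ∈ (Walk.cons hclose p).support, ∃ k ≤ n, w k = x := by
    intro x hx
    rw [Walk.support_cons, List.mem_cons, hs, List.mem_map] at hx
    rcases hx with rfl | ⟨k, hk, rfl⟩
    · exact ⟨n, le_rfl, rfl⟩
    · exact ⟨k, by grind, rfl⟩
  have key : ∀ i j, i < j → j ≤ n → s(w i, w j) ∉ (Walk.cons hclose p).edges →
      i + 2 ≤ j ∧ (i = 0 → j ≠ n) := by
    intro i j hij hj hnot
    rw [Walk.edges_cons, List.mem_cons, he, List.mem_map, not_or] at hnot
    refine ⟨?_, ?_⟩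
    · by_contra hlt
      obtain rfl : j = i + 1 := by omega
      exact hnot.2 ⟨i, List.mem_range.mpr (by omega), rfl⟩
    · rintro rfl rfl
      exact hnot.1 Sym2.eq_swap
  obtain ⟨i, hi, rfl⟩ := hmem a ha
  obtain ⟨j, hj, rfl⟩ := hmem b hb
  rcases lt_trichotomy i j with hij | rfl | hij
  · obtain ⟨h1, h2⟩ := key i j hij hj hne
    exact ⟨i, j, h1, hj, h2, hab⟩
  · exact (G.irrefl hab).elim
  · obtain ⟨h1, h2⟩ := key j i hij hi (by rwa [Sym2.eq_swap])
    exact ⟨j, i, h1, hi, h2, hab.symm⟩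

end SimpleGraph

/-- **Lemma 12 (appendix)**: Let `G` be a finite chordal simple graph (every cycle of length
at least 4 has a chord), and let `r` be an orientation of `G`.  If `r` has a directed cycle
(of length `m ≥ 3`), then `r` has a directed cycle of length 3. -/
theorem directed_triangle_of_directed_cycle_chordal
    {V : Type*} [Fintype V] (G : SimpleGraph V)
    (hchordal : ∀ (v : V) (p : G.Walk v v), p.IsCycle → 4 ≤ p.length →
      ∃ a b : V, G.Adj a b ∧ a ∈ p.support ∧ b ∈ p.support ∧ s(a, b) ∉ p.edges)
    (r : V → V → Prop)
    (hor : ∀ u v : V, (G.Adj u v ↔ (r u v ∨ r v u)) ∧ ¬ (r u v ∧ r v u))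
    (hcyc : ∃ (m : ℕ) (w : ℕ → V), 3 ≤ m ∧ w m = w 0 ∧
      (∀ i < m, ∀ j < m, w i = w j → i = j) ∧ ∀ i < m, r (w i) (w (i + 1))) :
    ∃ a b c : V, r a b ∧ r b c ∧ r c a := by
  obtain ⟨m, hcyc⟩ := hcyc
  induction m using Nat.strong_induction_on with
  | _ m ih =>
    obtain ⟨w, hm, hclose, hinj, hr⟩ := hcyc
    have hlast : r (w (m - 1)) (w 0) := by
      have := hr (m - 1) (by omega)
      rwa [Nat.sub_add_cancel (by omega), hclose] at this
    rcases hm.eq_or_lt with rfl | hm4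
    · exact ⟨w 0, w 1, w 2, hr 0 (by omega), hr 1 (by omega), hlast⟩
    obtain ⟨i, j, hij, hj, hends, hadj⟩ := G.exists_chord_of_cyclic_sequence hchordal
      (n := m - 1) (by omega) w (fun i hi j hj => hinj i (by omega) j (by omega))
      (fun i hi => (hor _ _).1.mpr (.inl (hr i (by omega)))) ((hor _ _).1.mpr (.inl hlast))
    rcases (hor _ _).1.mp hadj with hrij | hrji
    · refine ih (m - (j - i - 1)) (by omega)
        ⟨fun k => if k ≤ i then w k else w (k + (j - i - 1)), by omega, ?_, ?_, ?_⟩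
      · have h1 : ¬ m - (j - i - 1) ≤ i := by omega
        have h2 : m - (j - i - 1) + (j - i - 1) = m := by omega
        simp [h1, h2, hclose]
      · intro a ha b hb hab
        dsimp only at hab
        split_ifs at hab
        all_goals
          have := hinj _ (by omega) _ (by omega) hab
          omega
      · intro k hk
        rcases lt_trichotomy k i with hki | rfl | hki
        · simpa [hki.le, Nat.succ_le_of_lt hki] using hr k (by omega)
        · have h1 : k + 1 + (j - k - 1) = j := by omega
          simpa [h1] using hrij
        · have h1 : ¬ k ≤ i := by omega
          have h2 : ¬ k + 1 ≤ i := by omega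
          have := hr (k + (j - i - 1)) (by omega)
          simp only [if_neg h1, if_neg h2]
          rwa [Nat.add_right_comm] at this
    · refine ih (j - i + 1) (by omega)
        ⟨fun k => if k ≤ j - i then w (i + k) else w i, by omega, by simp, ?_, ?_⟩
      · intro a ha b hb hab
        have h1 : a ≤ j - i := by omega
        have h2 : b ≤ j - i := by omega
        simp only [if_pos h1, if_pos h2] at hab
        have := hinj _ (by omega) _ (by omega) hab
        omega
      · intro k hk
        rcases (Nat.le_of_lt_succ hk).eq_or_lt with rfl | hk
        · have h1 : i + (j - i) = j := by omega
          simpa [h1] using hrji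
        · simp only [if_pos hk.le, if_pos (Nat.succ_le_of_lt hk)]
          exact hr (i + k) (by omega)
end
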